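/- arXiv:2511.20442 — 9 statements merged into one kernel-verified Lean document; each statement's English description precedes it below -/
import Mathlib

section
/- Let u, m : ℝ × ℝ → ℝ be smooth with m = u − u_{xx}, m(x,t) + 1 > 0 for all (x,t), and suppose the Camassa–Holm equation holds in the form (√(m+1))_t = −( u √(m+1) )_x on ℝ × ℝ. Let y : ℝ × ℝ → ℝ be smooth with y_x = √(m+1) and y_t = −u √(m+1), and let x̃ : ℝ × ℝ → ℝ be smooth with x̃( y(x,t), t ) = x and y( x̃(η,t), t ) = η for all x, η, t. Define m̂(η,t) := m( x̃(η,t), t ), û(η,t) := u( x̃(η,t), t ), v̂(η,t) := u_x( x̃(η,t), t ). Then for all (η,t): (√(m̂+1))_t = −v̂ √(m̂+1), v̂ = û_η √(m̂+1), and m̂ = û − v̂_η √(m̂+1). -/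
/-- Partial derivative with respect to the first variable. -/
noncomputable def pd1 (f : ℝ → ℝ → ℝ) (x t : ℝ) : ℝ := deriv (fun x' => f x' t) x

/-- Partial derivative with respect to the second (time) variable. -/
noncomputable def pd2 (f : ℝ → ℝ → ℝ) (x t : ℝ) : ℝ := deriv (fun t' => f x t') t

theorem hasDerivAt_pd1 {f : ℝ → ℝ → ℝ} (hf : Differentiable ℝ (Function.uncurry f)) (x t : ℝ) :
    HasDerivAt (fun x' => f x' t) (pd1 f x t) x := by
  have h : DifferentiableAt ℝ (fun x' => Function.uncurry f (x', t)) x := by fun_prop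
  exact h.hasDerivAt

theorem hasDerivAt_pd2 {f : ℝ → ℝ → ℝ} (hf : Differentiable ℝ (Function.uncurry f)) (x t : ℝ) :
    HasDerivAt (fun t' => f x t') (pd2 f x t) t := by
  have h : DifferentiableAt ℝ (fun t' => Function.uncurry f (x, t')) t := by fun_prop
  exact h.hasDerivAt

theorem pd1_eq_fderiv {f : ℝ → ℝ → ℝ} (hf : Differentiable ℝ (Function.uncurry f)) (x t : ℝ) :
    pd1 f x t = fderiv ℝ (Function.uncurry f) (x, t) (1, 0) :=
  (HasFDerivAt.comp_hasDerivAt (f := fun x' => (x', t)) x (hf (x, t)).hasFDerivAt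
    ((hasDerivAt_id x).prodMk (hasDerivAt_const x t))).deriv

theorem pd2_eq_fderiv {f : ℝ → ℝ → ℝ} (hf : Differentiable ℝ (Function.uncurry f)) (x t : ℝ) :
    pd2 f x t = fderiv ℝ (Function.uncurry f) (x, t) (0, 1) :=
  (HasFDerivAt.comp_hasDerivAt (f := fun t' => (x, t')) t (hf (x, t)).hasFDerivAt
    ((hasDerivAt_const t x).prodMk (hasDerivAt_id t))).deriv

theorem differentiable_uncurry_pd1 {f : ℝ → ℝ → ℝ}
    (hf : ContDiff ℝ (⊤ : ℕ∞) (Function.uncurry f)) :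
    Differentiable ℝ (Function.uncurry (pd1 f)) := by
  have h : Function.uncurry (pd1 f) =
      fun p => fderiv ℝ (Function.uncurry f) p (1, 0) := by
    ext ⟨x, t⟩
    exact pd1_eq_fderiv (hf.differentiable (by simp)) x t
  rw [h]
  have h' : Differentiable ℝ (fderiv ℝ (Function.uncurry f)) :=
    (hf.fderiv_right (m := (⊤ : ℕ∞)) le_rfl).differentiable (by simp)
  exact h'.clm_apply (differentiable_const _)

/-- Total derivative of `f` along the graph of a curve `g`. -/
theorem hasDerivAt_along_graph {f : ℝ → ℝ → ℝ} (hf : Differentiable ℝ (Function.uncurry f))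
    {g : ℝ → ℝ} {g' t : ℝ} (hg : HasDerivAt g g' t) :
    HasDerivAt (fun t' => f (g t') t') (pd1 f (g t) t * g' + pd2 f (g t) t) t := by
  have h := HasFDerivAt.comp_hasDerivAt (f := fun t' => (g t', t')) t
    (hf (g t, t)).hasFDerivAt (hg.prodMk (hasDerivAt_id t))
  refine h.congr_deriv ?_
  rw [pd1_eq_fderiv hf, pd2_eq_fderiv hf]
  have e : ((g', 1) : ℝ × ℝ) = g' • (1, 0) + (0, 1) := by simp
  rw [e, map_add, map_smul, smul_eq_mul, mul_comm]

/-- a solution of the Camassa–Holm equation in the `(x,t)` variables gives,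
via the change of variable `y`, a solution of the Camassa–Holm system in the `(y,t)` variables. -/
theorem statement1
    (u m : ℝ → ℝ → ℝ)
    (hu : ContDiff ℝ (⊤ : ℕ∞) (Function.uncurry u))
    (hmS : ContDiff ℝ (⊤ : ℕ∞) (Function.uncurry m))
    (hm : ∀ x t, m x t = u x t - pd1 (pd1 u) x t)
    (hpos : ∀ x t, m x t + 1 > 0)
    (hCH : ∀ x t, pd2 (fun x' t' => Real.sqrt (m x' t' + 1)) x t
        = - pd1 (fun x' t' => u x' t' * Real.sqrt (m x' t' + 1)) x t)
    (y : ℝ → ℝ → ℝ) (hyS : ContDiff ℝ (⊤ : ℕ∞) (Function.uncurry y))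
    (hyx : ∀ x t, pd1 y x t = Real.sqrt (m x t + 1))
    (hyt : ∀ x t, pd2 y x t = - u x t * Real.sqrt (m x t + 1))
    (xt : ℝ → ℝ → ℝ) (hxtS : ContDiff ℝ (⊤ : ℕ∞) (Function.uncurry xt))
    (hinv1 : ∀ x t, xt (y x t) t = x)
    (hinv2 : ∀ η t, y (xt η t) t = η)
    (mh uh vh : ℝ → ℝ → ℝ)
    (hmh : ∀ η t, mh η t = m (xt η t) t)
    (huh : ∀ η t, uh η t = u (xt η t) t)
    (hvh : ∀ η t, vh η t = pd1 u (xt η t) t) :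
    ∀ η t,
      (pd2 (fun η' t' => Real.sqrt (mh η' t' + 1)) η t
        = - vh η t * Real.sqrt (mh η t + 1))
      ∧ (vh η t = pd1 uh η t * Real.sqrt (mh η t + 1))
      ∧ (mh η t = uh η t - pd1 vh η t * Real.sqrt (mh η t + 1)) := by
  intro η t
  have du := hu.differentiable (by simp)
  have dy := hyS.differentiable (by simp)
  have dxt := hxtS.differentiable (by simp)
  have dux := differentiable_uncurry_pd1 hu
  have ds : Differentiable ℝ (Function.uncurry fun x' t' => Real.sqrt (m x' t' + 1)) :=
    ((hmS.differentiable (by simp)).add_const 1).sqrt fun p => (hpos p.1 p.2).ne'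
  have hs : 0 < Real.sqrt (m (xt η t) t + 1) := Real.sqrt_pos.2 (hpos _ _)
  have hxt1 := hasDerivAt_pd1 dxt η t
  have hxt2 := hasDerivAt_pd2 dxt η t
  have eη : Real.sqrt (m (xt η t) t + 1) * pd1 xt η t = 1 := by
    have h := (hasDerivAt_pd1 dy (xt η t) t).comp η hxt1
    have h' : ((fun x' => y x' t) ∘ fun η' => xt η' t) = id := funext fun η' => hinv2 η' t
    rw [h', hyx] at h
    exact h.unique (hasDerivAt_id η)
  have et : pd2 xt η t = u (xt η t) t := by
    have h := hasDerivAt_along_graph dy hxt2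
    simp only [hinv2, hyx, hyt] at h
    have h' := h.unique (hasDerivAt_const t η)
    apply mul_left_cancel₀ hs.ne'
    linarith
  refine ⟨?_, ?_, ?_⟩
  · have h := (hasDerivAt_along_graph ds hxt2).deriv
    have hprod := ((hasDerivAt_pd1 du (xt η t) t).mul (hasDerivAt_pd1 ds (xt η t) t)).deriv
    have hc := hCH (xt η t) t
    simp only [pd2, hmh, hvh] at h hc ⊢
    rw [h]
    change _ = -deriv _ _ at hc
    rw [hc]
    change deriv (fun x' => u x' t * Real.sqrt (m x' t + 1)) (xt η t) = _ at hprod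
    rw [hprod, show deriv (fun t' => xt η t') t = u (xt η t) t from et]
    ring
  · have h : pd1 uh η t = pd1 u (xt η t) t * pd1 xt η t := by
      have e : (fun η' => uh η' t) = (fun x' => u x' t) ∘ fun η' => xt η' t :=
        funext fun η' => huh η' t
      rw [pd1, e]
      exact ((hasDerivAt_pd1 du (xt η t) t).comp η hxt1).deriv
    rw [h, hvh, hmh]
    linear_combination -pd1 u (xt η t) t * eη
  · have h : pd1 vh η t = pd1 (pd1 u) (xt η t) t * pd1 xt η t := by
      have e : (fun η' => vh η' t) = (fun x' => pd1 u x' t) ∘ fun η' => xt η' t :=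
        funext fun η' => hvh η' t
      rw [pd1, e]
      exact ((hasDerivAt_pd1 dux (xt η t) t).comp η hxt1).deriv
    rw [h, huh, hmh]
    linear_combination hm (xt η t) t + pd1 (pd1 u) (xt η t) t * eη
end

section
/- Let û, v̂, m̂ : ℝ × ℝ → ℝ be smooth with m̂(y,t) + 1 > 0 for all (y,t), satisfying the Camassa–Holm system in the (y,t) variables: (√(m̂+1))_t = −v̂ √(m̂+1), v̂ = û_y √(m̂+1), and m̂ = û − v̂_y √(m̂+1). Let x̃ : ℝ × ℝ → ℝ be smooth with x̃_y = 1/√(m̂+1) and x̃_t = û, and let ỹ : ℝ × ℝ → ℝ be smooth with ỹ( x̃(η,t), t ) = η and x̃( ỹ(x,t), t ) = x for all η, x, t. Define u(x,t) := û( ỹ(x,t), t ) and m(x,t) := m̂( ỹ(x,t), t ). Then m = u − u_{xx} and (√(m+1))_t = −( u √(m+1) )_x on ℝ × ℝ. -/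
/-- The section of a differentiable function in its first variable has derivative `pd1`. -/
lemma hasDerivAt_pd1_s2 {F : ℝ → ℝ → ℝ} (hF : Differentiable ℝ (Function.uncurry F)) (a t : ℝ) :
    HasDerivAt (fun s => F s t) (pd1 F a t) a := by
  have h : DifferentiableAt ℝ (Function.uncurry F ∘ fun s : ℝ => (s, t)) a :=
    (hF _).comp a (by fun_prop)
  exact h.hasDerivAt

/-- Chain rule in the first variable, the second one being fixed. -/
lemma hasDerivAt_comp_fst {F : ℝ → ℝ → ℝ} (hF : Differentiable ℝ (Function.uncurry F))
    {g : ℝ → ℝ} {g' x : ℝ} (t : ℝ) (hg : HasDerivAt g g' x) :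
    HasDerivAt (fun s => F (g s) t) (pd1 F (g x) t * g') x :=
  (hasDerivAt_pd1_s2 hF (g x) t).comp x hg

/-- The section of a differentiable function in its second variable has derivative `pd2`. -/
lemma hasDerivAt_pd2_s2 {F : ℝ → ℝ → ℝ} (hF : Differentiable ℝ (Function.uncurry F)) (a t : ℝ) :
    HasDerivAt (fun s => F a s) (pd2 F a t) t := by
  have h : DifferentiableAt ℝ (Function.uncurry F ∘ fun s : ℝ => (a, s)) t :=
    (hF _).comp t (by fun_prop)
  exact h.hasDerivAt

/-- Chain rule along the curve `s ↦ (g s, s)`. -/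
lemma hasDerivAt_along {F : ℝ → ℝ → ℝ} (hF : Differentiable ℝ (Function.uncurry F))
    {g : ℝ → ℝ} {g' t : ℝ} (hg : HasDerivAt g g' t) :
    HasDerivAt (fun s => F (g s) s) (pd1 F (g t) t * g' + pd2 F (g t) t) t := by
  have hL := (hF (g t, t)).hasFDerivAt
  set L := fderiv ℝ (Function.uncurry F) (g t, t)
  have h1 : pd1 F (g t) t = L (1, 0) :=
    (HasFDerivAt.comp_hasDerivAt (f := fun s => (s, t)) (g t) hL
      ((hasDerivAt_id (g t)).prodMk (hasDerivAt_const (g t) t))).deriv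
  have h2 : pd2 F (g t) t = L (0, 1) :=
    (HasFDerivAt.comp_hasDerivAt (f := fun s => (g t, s)) t hL
      ((hasDerivAt_const t (g t)).prodMk (hasDerivAt_id t))).deriv
  have h3 : HasDerivAt (fun s => F (g s) s) (L (g', 1)) t :=
    HasFDerivAt.comp_hasDerivAt (f := fun s => (g s, s)) t hL (hg.prodMk (hasDerivAt_id t))
  have h4 : ((g', 1) : ℝ × ℝ) = g' • (1, 0) + (0, 1) := by simp
  rw [h4, map_add, map_smul, smul_eq_mul, mul_comm] at h3
  rwa [h1, h2]

/-- a solution of the Camassa–Holm system in the `(y,t)` variables gives,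
via the inverse change of variable, a solution of the Camassa–Holm equation in the
`(x,t)` variables. -/
theorem statement2
    (uh vh mh : ℝ → ℝ → ℝ)
    (huhS : ContDiff ℝ (⊤ : ℕ∞) (Function.uncurry uh))
    (hvhS : ContDiff ℝ (⊤ : ℕ∞) (Function.uncurry vh))
    (hmhS : ContDiff ℝ (⊤ : ℕ∞) (Function.uncurry mh))
    (hpos : ∀ y t, mh y t + 1 > 0)
    (hCH1 : ∀ y t, pd2 (fun y' t' => Real.sqrt (mh y' t' + 1)) y t
        = - vh y t * Real.sqrt (mh y t + 1))
    (hCH2 : ∀ y t, vh y t = pd1 uh y t * Real.sqrt (mh y t + 1))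
    (hCH3 : ∀ y t, mh y t = uh y t - pd1 vh y t * Real.sqrt (mh y t + 1))
    (xt : ℝ → ℝ → ℝ) (hxtS : ContDiff ℝ (⊤ : ℕ∞) (Function.uncurry xt))
    (hxty : ∀ η t, pd1 xt η t = 1 / Real.sqrt (mh η t + 1))
    (hxtt : ∀ η t, pd2 xt η t = uh η t)
    (yt : ℝ → ℝ → ℝ) (hytS : ContDiff ℝ (⊤ : ℕ∞) (Function.uncurry yt))
    (hinv1 : ∀ η t, yt (xt η t) t = η)
    (hinv2 : ∀ x t, xt (yt x t) t = x)
    (u m : ℝ → ℝ → ℝ)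
    (hud : ∀ x t, u x t = uh (yt x t) t)
    (hmd : ∀ x t, m x t = mh (yt x t) t) :
    (∀ x t, m x t = u x t - pd1 (pd1 u) x t)
    ∧ (∀ x t, pd2 (fun x' t' => Real.sqrt (m x' t' + 1)) x t
        = - pd1 (fun x' t' => u x' t' * Real.sqrt (m x' t' + 1)) x t) := by
  have hne : ((⊤ : ℕ∞) : WithTop ℕ∞) ≠ 0 := by simp
  have huD := huhS.differentiable hne
  have hvD := hvhS.differentiable hne
  have hxD := hxtS.differentiable hne
  have hyD := hytS.differentiable hne
  obtain ⟨R, hR⟩ : ∃ R : ℝ → ℝ → ℝ, R = fun y t => Real.sqrt (mh y t + 1) := ⟨_, rfl⟩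
  have hRv : ∀ y t, Real.sqrt (mh y t + 1) = R y t := fun y t => by rw [hR]
  have hR0 : ∀ y t, R y t ≠ 0 := fun y t => by
    rw [← hRv]; exact (Real.sqrt_pos.2 (hpos y t)).ne'
  have hRD : Differentiable ℝ (Function.uncurry R) := by
    rw [hR]
    exact ((hmhS.differentiable hne).add_const 1).sqrt fun p => (hpos p.1 p.2).ne'
  simp only [hRv] at hCH1 hCH2 hCH3 hxty
  have hyx : ∀ x t, HasDerivAt (fun s => yt s t) (R (yt x t) t) x := fun x t => by
    have h := hasDerivAt_pd1_s2 hyD x t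
    have hc := hasDerivAt_comp_fst hxD t h
    simp only [hinv2] at hc
    have he := hc.unique (hasDerivAt_id x)
    rw [hxty, one_div, inv_mul_eq_one₀ (hR0 _ _)] at he
    rwa [he]
  have hyt : ∀ x t, HasDerivAt (fun s => yt x s) (-(uh (yt x t) t * R (yt x t) t)) t :=
    fun x t => by
      have h := hasDerivAt_pd2_s2 hyD x t
      have hc := hasDerivAt_along hxD h
      simp only [hinv2] at hc
      have he := hc.unique (hasDerivAt_const t x)
      rw [hxty, hxtt] at he
      have := hR0 (yt x t) t
      have he' : pd2 yt x t = -(uh (yt x t) t * R (yt x t) t) := by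
        field_simp at he
        linarith
      rwa [he'] at h
  have hux : ∀ x t, HasDerivAt (fun s => uh (yt s t) t) (vh (yt x t) t) x := fun x t => by
    rw [hCH2]
    exact hasDerivAt_comp_fst huD t (hyx x t)
  obtain rfl : u = fun x t => uh (yt x t) t := funext₂ hud
  obtain rfl : m = fun x t => mh (yt x t) t := funext₂ hmd
  simp only [hRv]
  refine ⟨fun x t => ?_, fun x t => ?_⟩
  · have h1 : pd1 (fun x t => uh (yt x t) t) = fun x t => vh (yt x t) t :=
      funext₂ fun x t => (hux x t).deriv
    have h2 : pd1 (fun x t => vh (yt x t) t) x t = pd1 vh (yt x t) t * R (yt x t) t :=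
      (hasDerivAt_comp_fst hvD t (hyx x t)).deriv
    rw [h1, h2, hCH3]
  · have h1 : pd2 (fun x t => R (yt x t) t) x t = _ := (hasDerivAt_along hRD (hyt x t)).deriv
    have h2 : pd1 (fun x t => uh (yt x t) t * R (yt x t) t) x t = _ :=
      ((hux x t).mul (hasDerivAt_comp_fst hRD t (hyx x t))).deriv
    have h3 : pd2 R (yt x t) t = -vh (yt x t) t * R (yt x t) t := hCH1 _ _
    rw [h1, h2, h3]
    ring
end

section
/- Let θ > 0 and let û, v̂, m̂ : ℝ × ℝ → ℝ be smooth with m̂(y,t) + 1 > 0 for all (y,t), θ-periodic in the first variable (f(y+θ,t) = f(y,t) for f = û, v̂, m̂), and satisfying the Camassa–Holm system in the (y,t) variables: (√(m̂+1))_t = −v̂ √(m̂+1), v̂ = û_y √(m̂+1), m̂ = û − v̂_y √(m̂+1). Define x̃(η,t) := ∫₀^η 1/√(m̂(ξ,t)+1) dξ + ∫₀ᵗ û(0,ζ) dζ, let ỹ : ℝ × ℝ → ℝ be smooth with ỹ( x̃(η,t), t ) = η and x̃( ỹ(x,t), t ) = x for all η, x, t, and set L := ∫₀^θ 1/√(m̂(ξ,0)+1)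 dξ. Define u(x,t) := û( ỹ(x,t), t ) and m(x,t) := m̂( ỹ(x,t), t ). Then for all (x,t): ỹ(x + L, t) − ỹ(x, t) = θ, u(x + L, t) = u(x, t), m(x + L, t) = m(x, t); moreover ∫₀ᴸ √(m(ξ,0)+1) dξ = θ. -/
open MeasureTheory Set

/-- If `∂ₜ f = ∂_y g` with `g` being `θ`-periodic in `y`, then `∫₀^θ f(·, t)` does not depend
on `t`. -/
theorem integral_eq_of_conservation_law {θ : ℝ} {f g h : ℝ → ℝ → ℝ}
    (hf : ∀ y t, HasDerivAt (fun s => f y s) (h y t) t)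
    (hg : ∀ y t, HasDerivAt (fun z => g z t) (h y t) y)
    (hfc : ∀ t, Continuous fun y => f y t)
    (hhc : Continuous (Function.uncurry h))
    (hper : ∀ t, g θ t = g 0 t) (s t : ℝ) :
    ∫ y in (0 : ℝ)..θ, f y t = ∫ y in (0 : ℝ)..θ, f y s := by
  have hhy (t : ℝ) : Continuous fun y => h y t := by fun_prop
  have hht (y : ℝ) : Continuous fun t => h y t := by fun_prop
  have hint : IntegrableOn (Function.uncurry h) (uIoc 0 θ ×ˢ uIoc s t) :=
    (hhc.continuousOn.integrableOn_compact (isCompact_uIcc.prod isCompact_uIcc)).mono_set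
      (prod_mono uIoc_subset_uIcc uIoc_subset_uIcc)
  rw [← sub_eq_zero, ← intervalIntegral.integral_sub ((hfc t).intervalIntegrable _ _)
    ((hfc s).intervalIntegrable _ _)]
  calc ∫ y in (0 : ℝ)..θ, (f y t - f y s)
      = ∫ y in (0 : ℝ)..θ, ∫ r in s..t, h y r := by
        congr 1 with y
        exact (intervalIntegral.integral_eq_sub_of_hasDerivAt (fun r _ => hf y r)
          ((hht y).intervalIntegrable _ _)).symm
    _ = ∫ r in s..t, ∫ y in (0 : ℝ)..θ, h y r := intervalIntegral_intervalIntegral_swap hint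
    _ = ∫ r in s..t, (0 : ℝ) := by
        congr 1 with r
        rw [intervalIntegral.integral_eq_sub_of_hasDerivAt (fun y _ => hg y r)
          ((hhy r).intervalIntegrable _ _), hper, sub_self]
    _ = 0 := intervalIntegral.integral_zero

/-- a `θ`-periodic solution of the Camassa–Holm system in the `(y,t)`
variables gives, via the inverse change of variable, an `L`-periodic solution in the
`(x,t)` variables, with `L = ∫₀^θ (m̂(ξ,0)+1)^{-1/2} dξ` and `∫₀ᴸ √(m(ξ,0)+1) dξ = θ`. -/
theorem statement4
    (θ : ℝ) (hθpos : 0 < θ)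
    (uh vh mh : ℝ → ℝ → ℝ)
    (huhS : ContDiff ℝ (⊤ : ℕ∞) (Function.uncurry uh))
    (hvhS : ContDiff ℝ (⊤ : ℕ∞) (Function.uncurry vh))
    (hmhS : ContDiff ℝ (⊤ : ℕ∞) (Function.uncurry mh))
    (hpos : ∀ y t, mh y t + 1 > 0)
    (hperu : ∀ y t, uh (y + θ) t = uh y t)
    (hperv : ∀ y t, vh (y + θ) t = vh y t)
    (hperm : ∀ y t, mh (y + θ) t = mh y t)
    (hCH1 : ∀ y t, pd2 (fun y' t' => Real.sqrt (mh y' t' + 1)) y t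
        = - vh y t * Real.sqrt (mh y t + 1))
    (hCH2 : ∀ y t, vh y t = pd1 uh y t * Real.sqrt (mh y t + 1))
    (hCH3 : ∀ y t, mh y t = uh y t - pd1 vh y t * Real.sqrt (mh y t + 1))
    (xt : ℝ → ℝ → ℝ)
    (hxt : ∀ η t, xt η t = (∫ ξ in (0:ℝ)..η, 1 / Real.sqrt (mh ξ t + 1))
        + ∫ ζ in (0:ℝ)..t, uh 0 ζ)
    (yt : ℝ → ℝ → ℝ) (hytS : ContDiff ℝ (⊤ : ℕ∞) (Function.uncurry yt))
    (hinv1 : ∀ η t, yt (xt η t) t = η)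
    (hinv2 : ∀ x t, xt (yt x t) t = x)
    (L : ℝ) (hLdef : L = ∫ ξ in (0:ℝ)..θ, 1 / Real.sqrt (mh ξ 0 + 1))
    (u m : ℝ → ℝ → ℝ)
    (hud : ∀ x t, u x t = uh (yt x t) t)
    (hmd : ∀ x t, m x t = mh (yt x t) t) :
    (∀ x t, yt (x + L) t - yt x t = θ)
    ∧ (∀ x t, u (x + L) t = u x t)
    ∧ (∀ x t, m (x + L) t = m x t)
    ∧ ((∫ ξ in (0:ℝ)..L, Real.sqrt (m ξ 0 + 1)) = θ) := by
  have hsq (y t : ℝ) : 0 < Real.sqrt (mh y t + 1) := Real.sqrt_pos.2 (hpos y t)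
  have hm : Continuous (Function.uncurry mh) := hmhS.continuous
  have hv : Continuous (Function.uncurry vh) := hvhS.continuous
  have hsc : Continuous fun p : ℝ × ℝ => Real.sqrt (mh p.1 p.2 + 1) :=
    Real.continuous_sqrt.comp (hm.add continuous_const)
  have hPc (t : ℝ) : Continuous fun y => 1 / Real.sqrt (mh y t + 1) :=
    continuous_const.div (hsc.comp (by fun_prop : Continuous fun y : ℝ => (y, t)))
      fun y => (hsq y t).ne'
  have hPt (y t : ℝ) : HasDerivAt (fun s => 1 / Real.sqrt (mh y s + 1))
      (vh y t / Real.sqrt (mh y t + 1)) t := by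
    have hmt : Differentiable ℝ fun s => mh y s :=
      (hmhS.differentiable (by simp)).comp
        (by fun_prop : Differentiable ℝ fun s : ℝ => (y, s))
    have hd : HasDerivAt (fun s => Real.sqrt (mh y s + 1))
        (-vh y t * Real.sqrt (mh y t + 1)) t := by
      rw [← hCH1 y t]
      exact (((hmt t).add_const 1).sqrt (hpos y t).ne').hasDerivAt
    have hne := (hsq y t).ne'
    simp only [one_div]
    refine (hd.fun_inv hne).congr_deriv ?_
    rw [div_eq_div_iff (pow_ne_zero 2 hne) hne]
    ring
  have huy (y t : ℝ) : HasDerivAt (fun z => uh z t) (vh y t / Real.sqrt (mh y t + 1)) y := by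
    have hut : Differentiable ℝ fun z => uh z t :=
      (huhS.differentiable (by simp)).comp
        (by fun_prop : Differentiable ℝ fun z : ℝ => (z, t))
    rw [hCH2, mul_div_cancel_right₀ _ (hsq y t).ne']
    exact (hut y).hasDerivAt
  have hperiod (t : ℝ) : ∫ ξ in (0 : ℝ)..θ, 1 / Real.sqrt (mh ξ t + 1) = L := by
    rw [hLdef]
    exact integral_eq_of_conservation_law hPt huy hPc
      (hv.div hsc fun p => (hsq p.1 p.2).ne') (fun t => by simpa using hperu 0 t) 0 t
  have hshift (η t : ℝ) : xt (η + θ) t = xt η t + L := by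
    have hper : Function.Periodic (fun ξ => 1 / Real.sqrt (mh ξ t + 1)) θ := fun ξ => by
      simp only [hperm]
    have hadd := hper.intervalIntegral_add_eq η 0
    rw [zero_add, hperiod] at hadd
    rw [hxt, hxt, ← hadd, ← intervalIntegral.integral_add_adjacent_intervals
      ((hPc t).intervalIntegrable 0 η) ((hPc t).intervalIntegrable η (η + θ))]
    ring
  have hyt (x t : ℝ) : yt (x + L) t = yt x t + θ := by
    rw [← hinv1 (yt x t + θ) t, hshift, hinv2]
  refine ⟨fun x t => by rw [hyt]; ring, fun x t => by rw [hud, hud, hyt, hperu],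
    fun x t => by rw [hmd, hmd, hyt, hperm], ?_⟩
  have hx0 : xt 0 0 = 0 := by simp [hxt]
  have hxθ : xt θ 0 = L := by simpa [hx0] using hshift 0 0
  have hxd (η : ℝ) : HasDerivAt (fun z => xt z 0) (1 / Real.sqrt (mh η 0 + 1)) η := by
    simp only [hxt]
    exact ((hPc 0).integral_hasStrictDerivAt 0 η).hasDerivAt.add_const _
  have hmc : Continuous fun ξ => Real.sqrt (m ξ 0 + 1) := by
    simp only [hmd]
    exact hsc.comp (((hytS.continuous.comp
      (by fun_prop : Continuous fun ξ : ℝ => (ξ, (0 : ℝ)))).prodMk continuous_const))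
  have hsubst := intervalIntegral.integral_comp_mul_deriv (a := 0) (b := θ)
    (fun η _ => hxd η) (hPc 0).continuousOn hmc
  rw [hx0, hxθ] at hsubst
  rw [← hsubst]
  simp [hmd, hinv1, (hsq _ _).ne']
end

section
/- Let m : ℝ → ℝ be smooth with m(x) + 1 > 0 for all x, let λ ∈ ℂ and k ∈ ℂ with k ≠ 0 and k² = −λ − 1/4, and let ψ : ℝ → ℂ be smooth with ψ''(x) = (1/4) ψ(x) + λ (m(x)+1) ψ(x) for all x. Define Φ : ℝ → ℂ² by Φ(x) := (1/2) · [[1, −1/(i k)], [1, 1/(i k)]] · [[ (m(x)+1)^{1/4}, 0 ], [ 0, (m(x)+1)^{−1/4} ]] · (ψ(x), ψ'(x))ᵀ. Then for all x: Φ'(x) + i k √(m(x)+1) σ₃ Φ(x) = U(x) Φ(x), where σ₃ = [[1,0],[0,−1]] and U(x) = ( m'(x) / (4 (m(x)+1)) ) · [[0,1],[1,0]] − ( 1/(8 i k) ) · ( m(x) / √(m(x)+1) ) · [[−1,−1],[1,1]]. -/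
open Matrix

/-- Derivative of a fourth root of a positive function. -/
theorem HasDerivAt.rpow_quarter {f : ℝ → ℝ} {f' x : ℝ} (hf : HasDerivAt f f' x)
    (hx : 0 < f x) :
    HasDerivAt (fun y => f y ^ ((1 : ℝ) / 4)) (f' / (4 * f x) * f x ^ ((1 : ℝ) / 4)) x := by
  convert hf.rpow_const (p := (1 : ℝ) / 4) (Or.inl hx.ne') using 1
  rw [Real.rpow_sub_one hx.ne']
  field_simp

/-- Derivative of the reciprocal of a fourth root of a positive function. -/
theorem HasDerivAt.rpow_neg_quarter {f : ℝ → ℝ} {f' x : ℝ} (hf : HasDerivAt f f' x)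
    (hx : 0 < f x) :
    HasDerivAt (fun y => f y ^ (-(1 : ℝ) / 4))
      (-(f' / (4 * f x) * f x ^ (-(1 : ℝ) / 4))) x := by
  convert hf.rpow_const (p := -(1 : ℝ) / 4) (Or.inl hx.ne') using 1
  rw [Real.rpow_sub_one hx.ne']
  field_simp

/-- the vector function `Φ` built from a solution `ψ` of the scalar
x-equation of the Camassa–Holm Lax pair satisfies the first-order `2×2` system
`Φ' + i k √(m+1) σ₃ Φ = U Φ`. -/
theorem statement6
    (m : ℝ → ℝ) (hm : ContDiff ℝ (⊤ : ℕ∞) m) (hpos : ∀ x, m x + 1 > 0)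
    (lam k : ℂ) (hk : k ≠ 0) (hk2 : k ^ 2 = -lam - 1/4)
    (ψ : ℝ → ℂ) (hψ : ContDiff ℝ (⊤ : ℕ∞) ψ)
    (hode : ∀ x, deriv (deriv ψ) x = (1/4 : ℂ) * ψ x + lam * ((m x + 1 : ℝ) : ℂ) * ψ x)
    (Φ : ℝ → Fin 2 → ℂ)
    (hΦ : ∀ x, Φ x = (1/2 : ℂ) •
      ((!![(1 : ℂ), -1/(Complex.I * k); 1, 1/(Complex.I * k)] *
        !![(((m x + 1) ^ ((1:ℝ)/4) : ℝ) : ℂ), 0;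
           0, (((m x + 1) ^ (-(1:ℝ)/4) : ℝ) : ℂ)]).mulVec ![ψ x, deriv ψ x])) :
    ∀ x, deriv Φ x
        + (Complex.I * k * (Real.sqrt (m x + 1) : ℂ)) • ((!![(1:ℂ), 0; 0, -1]).mulVec (Φ x))
      = ((((deriv m x / (4 * (m x + 1))) : ℝ) : ℂ) • !![(0:ℂ), 1; 1, 0]
          - (1/(8 * Complex.I * k)) • ((((m x / Real.sqrt (m x + 1)) : ℝ) : ℂ)
              • !![(-1:ℂ), -1; 1, 1])).mulVec (Φ x) := by
  intro x
  have hΦ₀ : ∀ y, Φ y 0 = (1/2 : ℂ) * ((((m y + 1) ^ ((1:ℝ)/4) : ℝ) : ℂ) * ψ y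
      - (((m y + 1) ^ (-(1:ℝ)/4) : ℝ) : ℂ) * deriv ψ y / (Complex.I * k)) := by
    intro y
    rw [hΦ y]
    simp only [Matrix.mul_fin_two, Matrix.mulVec_fin_two, Pi.smul_apply, smul_eq_mul,
      Matrix.cons_val_zero, Matrix.cons_val_one, Matrix.of_apply]
    ring
  have hΦ₁ : ∀ y, Φ y 1 = (1/2 : ℂ) * ((((m y + 1) ^ ((1:ℝ)/4) : ℝ) : ℂ) * ψ y
      + (((m y + 1) ^ (-(1:ℝ)/4) : ℝ) : ℂ) * deriv ψ y / (Complex.I * k)) := by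
    intro y
    rw [hΦ y]
    simp only [Matrix.mul_fin_two, Matrix.mulVec_fin_two, Pi.smul_apply, smul_eq_mul,
      Matrix.cons_val_zero, Matrix.cons_val_one, Matrix.of_apply]
    ring
  have hq : HasDerivAt (fun y => m y + 1) (deriv m x) x :=
    ((hm.differentiable (by simp)) x).hasDerivAt.add_const 1
  have ha := (hq.rpow_quarter (hpos x)).ofReal_comp
  have hb := (hq.rpow_neg_quarter (hpos x)).ofReal_comp
  have hψ' : HasDerivAt ψ (deriv ψ x) x := ((hψ.differentiable (by simp)) x).hasDerivAt
  have hψ'' : HasDerivAt (deriv ψ) (deriv (deriv ψ) x) x :=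
    (((contDiff_infty_iff_deriv.1 hψ).2.differentiable (by simp)) x).hasDerivAt
  rw [hode x] at hψ''
  have h₀ := ((ha.mul hψ').sub ((hb.mul hψ'').div_const (Complex.I * k))).const_mul (1/2 : ℂ)
  have h₁ := ((ha.mul hψ').add ((hb.mul hψ'').div_const (Complex.I * k))).const_mul (1/2 : ℂ)
  have hd₀ := h₀.congr_of_eventuallyEq (f₁ := fun y => Φ y 0) (.of_forall hΦ₀)
  have hd₁ := h₁.congr_of_eventuallyEq (f₁ := fun y => Φ y 1) (.of_forall hΦ₁)
  have hd : ∀ i, DifferentiableAt ℝ (fun y => Φ y i) x :=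
    Fin.forall_fin_two.2 ⟨hd₀.differentiableAt, hd₁.differentiableAt⟩
  have hderiv : ∀ i, deriv Φ x i = deriv (fun y => Φ y i) x := fun i => by
    rw [deriv_pi hd]
  have hapos : 0 < (m x + 1) ^ ((1:ℝ)/4) := Real.rpow_pos_of_pos (hpos x) _
  have hb_eq : (m x + 1) ^ (-(1:ℝ)/4) = ((m x + 1) ^ ((1:ℝ)/4))⁻¹ := by
    rw [neg_div, Real.rpow_neg (hpos x).le]
  have hsqrt : √(m x + 1) = ((m x + 1) ^ ((1:ℝ)/4)) ^ 2 := by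
    rw [Real.sqrt_eq_rpow, ← Real.rpow_mul_natCast (hpos x).le]
    norm_num
  have hpow : m x = ((m x + 1) ^ ((1:ℝ)/4)) ^ 4 - 1 := by
    rw [← Real.rpow_mul_natCast (hpos x).le]
    norm_num
  have hlam : lam = -k ^ 2 - 1/4 := by rw [hk2]; ring
  have e₀ := hd₀.deriv
  have e₁ := hd₁.deriv
  have f₀ := hΦ₀ x
  have f₁ := hΦ₁ x
  rw [hb_eq] at e₀ e₁ f₀ f₁
  rw [hsqrt]
  generalize (m x + 1) ^ ((1:ℝ)/4) = a at *
  have ha0 : (a : ℂ) ≠ 0 := by exact_mod_cast hapos.ne'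
  have hI := Complex.I_sq
  have hI0 := Complex.I_ne_zero
  have hI3 : Complex.I ^ 3 = -Complex.I := by rw [pow_succ, hI]; ring
  ext i
  fin_cases i
  · simp only [Fin.zero_eta, Pi.add_apply, Pi.smul_apply, hderiv, e₀,
      Matrix.mulVec_fin_two, Matrix.sub_apply, Matrix.smul_apply, smul_eq_mul,
      Matrix.mulVec, dotProduct, Fin.sum_univ_two, Matrix.of_apply,
      Matrix.cons_val', Matrix.cons_val_zero, Matrix.cons_val_one, f₀, f₁]
    rw [hpow, hlam]
    push_cast
    simp only [sub_add_cancel]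
    field_simp
    ring_nf
    simp only [hI, hI3]
    ring
  · simp only [Fin.mk_one, Pi.add_apply, Pi.smul_apply, hderiv, e₁,
      Matrix.mulVec_fin_two, Matrix.sub_apply, Matrix.smul_apply, smul_eq_mul,
      Matrix.mulVec, dotProduct, Fin.sum_univ_two, Matrix.of_apply,
      Matrix.cons_val', Matrix.cons_val_zero, Matrix.cons_val_one, f₀, f₁]
    rw [hpow, hlam]
    push_cast
    simp only [sub_add_cancel]
    field_simp
    ring_nf
    simp only [hI, hI3]
    ring
end

section
/- Let u, m : ℝ × ℝ → ℝ be smooth with m = u − u_{xx}, m(x,t) + 1 > 0 for all (x,t), satisfying (√(m+1))_t = −( u √(m+1) )_x on ℝ × ℝ. Let k ∈ ℂ with k ≠ 0 and λ := −k² − 1/4 ≠ 0. Let x̃, ỹ : ℝ × ℝ → ℝ be smooth with ỹ_x = √(m+1), ỹ_t = −u √(m+1), x̃( ỹ(x,t), t ) = x and ỹ( x̃(η,t), t ) = η for all x, η, t. Suppose Φ : ℝ × ℝ → M₂(ℂ) is smooth and satisfies Φ_x + i k √(m+1) σ₃ Φ = U Φ and Φ_t + i k ( −u √(m+1) + 1/(2λ)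 ) σ₃ Φ = V Φ, where σ₃ = [[1,0],[0,−1]], U = ( m_x / (4(m+1)) ) [[0,1],[1,0]] − (1/(8 i k)) ( m/√(m+1) ) [[−1,−1],[1,1]], and V = ( m_t/(4(m+1)) + u_x/2 ) [[0,1],[1,0]] + (1/(8 i k)) ( u(m+2)/√(m+1) ) [[−1,−1],[1,1]] + (i k/(4λ)) ( √(m+1) [[−1,1],[−1,1]] + (1/√(m+1)) [[−1,−1],[1,1]] ) + (i k/(2λ)) σ₃. Define Ψ̂(η,t) := Φ( x̃(η,t), t ), m̂(η,t) := m( x̃(η,t), t ), û(η,t) := u( x̃(η,t), t ). Then Ψ̂ satisfies: Ψ̂_η + i k σ₃ Ψ̂ = ( ( m̂_η / (4(m̂+1)) ) [[0,1],[1,0]] − (1/(8 i k)) ( m̂/(m̂+1) ) [[−1,−1],[1,1]] ) Ψ̂ and Ψ̂_t = ( −(i k/(4λ)) [[ √(m̂+1) + 1/√(m̂+1), −√(m̂+1) + 1/√(m̂+1) ], [ √(m̂+1) − 1/√(m̂+1), −√(m̂+1) − 1/√(m̂+1) ]] + (1/(4 i k)) ( û/√(m̂+1) ) [[−1,−1],[1,1]]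 ) Ψ̂. -/
open Matrix

/-- Entrywise partial derivative of a matrix-valued function, first variable. -/
noncomputable def pd1M (f : ℝ → ℝ → Matrix (Fin 2) (Fin 2) ℂ) (x t : ℝ) :
    Matrix (Fin 2) (Fin 2) ℂ :=
  Matrix.of fun i j => deriv (fun x' => f x' t i j) x

/-- Entrywise partial derivative of a matrix-valued function, second variable. -/
noncomputable def pd2M (f : ℝ → ℝ → Matrix (Fin 2) (Fin 2) ℂ) (x t : ℝ) :
    Matrix (Fin 2) (Fin 2) ℂ :=
  Matrix.of fun i j => deriv (fun t' => f x t' i j) t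

/-- Chain rule for a function of two real variables along a differentiable curve. -/
theorem hasDerivAt_comp_curve {E : Type*} [NormedAddCommGroup E] [NormedSpace ℝ E]
    {f : ℝ → ℝ → E} (hf : Differentiable ℝ (fun p : ℝ × ℝ => f p.1 p.2))
    {a b : ℝ → ℝ} {a' b' r : ℝ} (ha : HasDerivAt a a' r) (hb : HasDerivAt b b' r) :
    HasDerivAt (fun r => f (a r) (b r))
      (a' • deriv (fun x => f x (b r)) (a r) + b' • deriv (fun t => f (a r) t) (b r)) r := by
  have hL := (hf (a r, b r)).hasFDerivAt
  have h1 := HasFDerivAt.comp_hasDerivAt (a r) (f := fun x : ℝ => (x, b r)) hL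
    ((hasDerivAt_id (a r)).prodMk (hasDerivAt_const (a r) (b r)))
  have h2 := HasFDerivAt.comp_hasDerivAt (b r) (f := fun t : ℝ => (a r, t)) hL
    ((hasDerivAt_const (b r) (a r)).prodMk (hasDerivAt_id (b r)))
  have h := HasFDerivAt.comp_hasDerivAt r (f := fun r : ℝ => (a r, b r)) hL (ha.prodMk hb)
  have e1 : deriv (fun x => f x (b r)) (a r) = _ := h1.deriv
  have e2 : deriv (fun t => f (a r) t) (b r) = _ := h2.deriv
  rw [e1, e2, ← map_smul, ← map_smul, ← map_add]
  simpa [Function.comp_def] using h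

/-- A smooth function of two variables is differentiable in each of them separately. -/
theorem differentiable_slices {E : Type*} [NormedAddCommGroup E] [NormedSpace ℝ E]
    {f : ℝ → ℝ → E} (hf : Differentiable ℝ (fun p : ℝ × ℝ => f p.1 p.2)) (x t : ℝ) :
    DifferentiableAt ℝ (fun x' => f x' t) x ∧ DifferentiableAt ℝ (fun t' => f x t') t :=
  ⟨(hf (x, t)).comp x (f := fun x' : ℝ => (x', t)) (by fun_prop),
    (hf (x, t)).comp t (f := fun t' : ℝ => (x, t')) (by fun_prop)⟩

/-- the Lax pair of the Camassa–Holm equation in the `(x,t)` variables,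
transplanted via the change of variable `y`, takes the stated form in the `(y,t)`
variables. -/
theorem statement7
    (u m : ℝ → ℝ → ℝ)
    (hu : ContDiff ℝ (⊤ : ℕ∞) (Function.uncurry u))
    (hmS : ContDiff ℝ (⊤ : ℕ∞) (Function.uncurry m))
    (hm : ∀ x t, m x t = u x t - pd1 (pd1 u) x t)
    (hpos : ∀ x t, m x t + 1 > 0)
    (hCH : ∀ x t, pd2 (fun x' t' => Real.sqrt (m x' t' + 1)) x t
        = - pd1 (fun x' t' => u x' t' * Real.sqrt (m x' t' + 1)) x t)
    (k lam : ℂ) (hk : k ≠ 0) (hlam : lam = -k ^ 2 - 1/4) (hlam0 : lam ≠ 0)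
    (xt yt : ℝ → ℝ → ℝ)
    (hxtS : ContDiff ℝ (⊤ : ℕ∞) (Function.uncurry xt))
    (hytS : ContDiff ℝ (⊤ : ℕ∞) (Function.uncurry yt))
    (hyx : ∀ x t, pd1 yt x t = Real.sqrt (m x t + 1))
    (hytt : ∀ x t, pd2 yt x t = - u x t * Real.sqrt (m x t + 1))
    (hinv1 : ∀ x t, xt (yt x t) t = x)
    (hinv2 : ∀ η t, yt (xt η t) t = η)
    (Φ : ℝ → ℝ → Matrix (Fin 2) (Fin 2) ℂ)
    (hΦS : ∀ i j, ContDiff ℝ (⊤ : ℕ∞) (fun p : ℝ × ℝ => Φ p.1 p.2 i j))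
    (hLax1 : ∀ x t,
      pd1M Φ x t
          + (Complex.I * k * (Real.sqrt (m x t + 1) : ℂ)) • (!![(1:ℂ), 0; 0, -1] * Φ x t)
        = ((((pd1 m x t / (4 * (m x t + 1))) : ℝ) : ℂ) • !![(0:ℂ), 1; 1, 0]
            - (1/(8 * Complex.I * k)) • ((((m x t / Real.sqrt (m x t + 1)) : ℝ) : ℂ)
                • !![(-1:ℂ), -1; 1, 1])) * Φ x t)
    (hLax2 : ∀ x t,
      pd2M Φ x t
          + (Complex.I * k * (((- u x t * Real.sqrt (m x t + 1)) : ℝ) : ℂ)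
              + Complex.I * k / (2 * lam)) • (!![(1:ℂ), 0; 0, -1] * Φ x t)
        = ((((pd2 m x t / (4 * (m x t + 1)) + pd1 u x t / 2) : ℝ) : ℂ) • !![(0:ℂ), 1; 1, 0]
            + (1/(8 * Complex.I * k))
              • ((((u x t * (m x t + 2) / Real.sqrt (m x t + 1)) : ℝ) : ℂ)
                  • !![(-1:ℂ), -1; 1, 1])
            + (Complex.I * k / (4 * lam))
              • ((Real.sqrt (m x t + 1) : ℂ) • !![(-1:ℂ), 1; -1, 1]
                  + ((Real.sqrt (m x t + 1) : ℂ))⁻¹ • !![(-1:ℂ), -1; 1, 1])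
            + (Complex.I * k / (2 * lam)) • !![(1:ℂ), 0; 0, -1]) * Φ x t)
    (Ψ : ℝ → ℝ → Matrix (Fin 2) (Fin 2) ℂ)
    (hΨ : ∀ η t, Ψ η t = Φ (xt η t) t)
    (mh uh : ℝ → ℝ → ℝ)
    (hmh : ∀ η t, mh η t = m (xt η t) t)
    (huh : ∀ η t, uh η t = u (xt η t) t) :
    (∀ η t,
      pd1M Ψ η t + (Complex.I * k) • (!![(1:ℂ), 0; 0, -1] * Ψ η t)
        = ((((pd1 mh η t / (4 * (mh η t + 1))) : ℝ) : ℂ) • !![(0:ℂ), 1; 1, 0]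
            - (1/(8 * Complex.I * k)) • ((((mh η t / (mh η t + 1)) : ℝ) : ℂ)
                • !![(-1:ℂ), -1; 1, 1])) * Ψ η t)
    ∧ (∀ η t,
      pd2M Ψ η t
        = ((-(Complex.I * k / (4 * lam))) •
            !![((Real.sqrt (mh η t + 1) + 1 / Real.sqrt (mh η t + 1) : ℝ) : ℂ),
               ((- Real.sqrt (mh η t + 1) + 1 / Real.sqrt (mh η t + 1) : ℝ) : ℂ);
               ((Real.sqrt (mh η t + 1) - 1 / Real.sqrt (mh η t + 1) : ℝ) : ℂ),
               ((- Real.sqrt (mh η t + 1) - 1 / Real.sqrt (mh η t + 1) : ℝ) : ℂ)]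
          + (1/(4 * Complex.I * k)) • ((((uh η t / Real.sqrt (mh η t + 1)) : ℝ) : ℂ)
              • !![(-1:ℂ), -1; 1, 1])) * Ψ η t) := by
  have du : Differentiable ℝ (fun p : ℝ × ℝ => u p.1 p.2) := hu.differentiable (by simp)
  have dm : Differentiable ℝ (fun p : ℝ × ℝ => m p.1 p.2) := hmS.differentiable (by simp)
  have dx : Differentiable ℝ (fun p : ℝ × ℝ => xt p.1 p.2) := hxtS.differentiable (by simp)
  have dy : Differentiable ℝ (fun p : ℝ × ℝ => yt p.1 p.2) := hytS.differentiable (by simp)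
  have dΦ : ∀ i j, Differentiable ℝ (fun p : ℝ × ℝ => Φ p.1 p.2 i j) :=
    fun i j => (hΦS i j).differentiable (by simp)
  have hs : ∀ x t, 0 < Real.sqrt (m x t + 1) := fun x t => Real.sqrt_pos.2 (hpos x t)
  have hsq : ∀ x t, m x t = Real.sqrt (m x t + 1) ^ 2 - 1 := fun x t => by
    rw [Real.sq_sqrt (hpos x t).le]; ring
  have hx1 : ∀ η t, HasDerivAt (fun η' => xt η' t) (Real.sqrt (m (xt η t) t + 1))⁻¹ η := by
    intro η t
    have h := (differentiable_slices dx η t).1.hasDerivAt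
    have hc := hasDerivAt_comp_curve dy h (hasDerivAt_const η t)
    have h1 : deriv (fun x => yt x t) (xt η t) = _ := hyx (xt η t) t
    simp only [hinv2, h1, smul_eq_mul, zero_mul, add_zero] at hc
    rwa [eq_inv_of_mul_eq_one_left (hc.unique (hasDerivAt_id η))] at h
  have hx2 : ∀ η t, HasDerivAt (fun t' => xt η t') (u (xt η t) t) t := by
    intro η t
    have h := (differentiable_slices dx η t).2.hasDerivAt
    have hc := hasDerivAt_comp_curve dy h (hasDerivAt_id t)
    have h1 : deriv (fun x => yt x t) (xt η t) = _ := hyx (xt η t) t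
    have h2 : deriv (fun t' => yt (xt η t) t') t = _ := hytt (xt η t) t
    simp only [id, hinv2, h1, h2, smul_eq_mul] at hc
    have he := hc.unique (hasDerivAt_const t η)
    have : deriv (fun t' => xt η t') t = u (xt η t) t :=
      mul_right_cancel₀ (hs (xt η t) t).ne' (by linarith)
    rwa [this] at h
  have hΨ1 : ∀ η t, pd1M Ψ η t
      = ((Real.sqrt (m (xt η t) t + 1) : ℂ))⁻¹ • pd1M Φ (xt η t) t := by
    intro η t
    ext i j
    have := (hasDerivAt_comp_curve (f := fun x t => Φ x t i j) (dΦ i j) (hx1 η t) (hasDerivAt_const η t)).deriv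
    simpa [pd1M, hΨ] using this
  have hΨ2 : ∀ η t, pd2M Ψ η t
      = pd2M Φ (xt η t) t + (u (xt η t) t : ℂ) • pd1M Φ (xt η t) t := by
    intro η t
    ext i j
    have := (hasDerivAt_comp_curve (f := fun x t => Φ x t i j) (dΦ i j) (hx2 η t) (hasDerivAt_id t)).deriv
    simpa [pd1M, pd2M, hΨ, add_comm] using this
  have hm1 : ∀ η t, pd1 mh η t
      = pd1 m (xt η t) t / Real.sqrt (m (xt η t) t + 1) := by
    intro η t
    have := (hasDerivAt_comp_curve dm (hx1 η t) (hasDerivAt_const η t)).deriv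
    simp only [smul_eq_mul, zero_mul, add_zero] at this
    simp only [pd1, hmh, this]
    ring
  have hmt : ∀ x t, pd2 m x t / (4 * (m x t + 1)) + pd1 u x t / 2
      = - (u x t * pd1 m x t / (4 * (m x t + 1))) := by
    intro x t
    have h1 : HasDerivAt (fun x' => m x' t) (pd1 m x t) x :=
      (differentiable_slices dm x t).1.hasDerivAt
    have h2 : HasDerivAt (fun t' => m x t') (pd2 m x t) t :=
      (differentiable_slices dm x t).2.hasDerivAt
    have h3 : HasDerivAt (fun x' => u x' t) (pd1 u x t) x :=
      (differentiable_slices du x t).1.hasDerivAt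
    have e1 := ((h2.add_const 1).sqrt (hpos x t).ne').deriv
    have e2 := (h3.mul ((h1.add_const 1).sqrt (hpos x t).ne')).deriv
    have h := hCH x t
    have e2' : pd1 (fun x' t' => u x' t' * Real.sqrt (m x' t' + 1)) x t = _ := e2
    have e1' : pd2 (fun x' t' => Real.sqrt (m x' t' + 1)) x t = _ := e1
    rw [e1', e2'] at h
    have hq := Real.sq_sqrt (hpos x t).le
    have hp := (hs x t).ne'
    have hp' := (hpos x t).ne'
    field_simp at h ⊢
    rw [hq] at h
    linarith
  refine ⟨fun η t => ?_, fun η t => ?_⟩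
  · have L1 := eq_sub_of_add_eq (hLax1 (xt η t) t)
    rw [hΨ1, L1, hm1, hmh, hΨ]
    have hS : (Real.sqrt (m (xt η t) t + 1) : ℂ) ≠ 0 := by exact_mod_cast (hs _ _).ne'
    have hM : (m (xt η t) t : ℂ) = (Real.sqrt (m (xt η t) t + 1) : ℂ) ^ 2 - 1 := by
      exact_mod_cast hsq (xt η t) t
    push_cast
    generalize (Real.sqrt (m (xt η t) t + 1) : ℂ) = S at *
    rw [hM]
    simp only [sub_add_cancel]
    ext i j
    fin_cases i <;>
    · simp [Matrix.mul_apply, Matrix.vecMul, dotProduct, Fin.sum_univ_two]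
      field_simp
      ring
  · have L1 := eq_sub_of_add_eq (hLax1 (xt η t) t)
    have L2 := eq_sub_of_add_eq (hLax2 (xt η t) t)
    rw [hmt] at L2
    rw [hΨ2, L1, L2, hmh, huh, hΨ]
    have hS : (Real.sqrt (m (xt η t) t + 1) : ℂ) ≠ 0 := by exact_mod_cast (hs _ _).ne'
    have hM : (m (xt η t) t : ℂ) = (Real.sqrt (m (xt η t) t + 1) : ℂ) ^ 2 - 1 := by
      exact_mod_cast hsq (xt η t) t
    clear L1 L2
    push_cast
    generalize (Real.sqrt (m (xt η t) t + 1) : ℂ) = S at *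
    rw [hM]
    simp only [sub_add_cancel]
    clear hlam
    ext i j
    fin_cases i <;>
    · simp [Matrix.mul_apply, Matrix.vecMul, dotProduct, Fin.sum_univ_two]
      field_simp
      ring
end

section
/- Let E, a, a', b, b', R₁, R₂ ∈ ℂ with E ≠ 0, b' ≠ 0, R₂ ≠ 0, a a' − b b' = 1, and suppose R₁ and R₂ are the two roots of the quadratic polynomial −E b' X² + (E a' − a) X + b, i.e. R₁ + R₂ = (E a' − a)/(E b') and R₁ R₂ = −b/(E b'). Then a − b/R₂ ≠ 0 and a' − b' R₁ ≠ 0. -/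
/-- if `R₁, R₂` are the two roots of the quadratic
`−E b* X² + (E a* − a) X + b` and `a a* − b b* = 1`, then
`a − b/R₂ ≠ 0` and `a* − b* R₁ ≠ 0`, i.e. `(a − b 𝔯*) ≠ 0` and `(a* − b* 𝔯) ≠ 0`. -/
theorem statement13 (E a a' b b' R₁ R₂ : ℂ) (hE : E ≠ 0) (hb' : b' ≠ 0) (hR₂ : R₂ ≠ 0)
    (hdet : a * a' - b * b' = 1)
    (hsum : R₁ + R₂ = (E * a' - a) / (E * b'))
    (hprod : R₁ * R₂ = -b / (E * b')) :
    a - b / R₂ ≠ 0 ∧ a' - b' * R₁ ≠ 0 := by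
  have hEb : E * b' ≠ 0 := mul_ne_zero hE hb'
  rw [eq_div_iff hEb] at hsum hprod
  have hquot : b / R₂ = -(E * b' * R₁) := by
    rw [div_eq_iff hR₂]
    linear_combination hprod
  have hmul : (a - b / R₂) * (a' - b' * R₁) = 1 := by
    rw [hquot]
    linear_combination hdet - b' * R₁ * hsum + b' * hprod
  exact ⟨left_ne_zero_of_mul_eq_one hmul, right_ne_zero_of_mul_eq_one hmul⟩
end

section
/- Let q₁, q₂, f₁, f₂ be positive real numbers and B ∈ ℂ, and suppose the following four equations hold: f₂ (q₂ + q₂^{−1} − 4 B q₂) = f₁ (q₁ + q₁^{−1}); f₂^{−1} (q₂ − q₂^{−1} − 4 B q₂) = f₁^{−1} (q₁ − q₁^{−1}); f₂ (q₂ − q₂^{−1} + 4 B q₂) = f₁ (q₁ − q₁^{−1}); f₂^{−1} (q₂ + q₂^{−1} + 4 B q₂) = f₁^{−1} (q₁ + q₁^{−1}). Then q₁ = q₂, f₁ = f₂, and B = 0. -/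
/-- the system arising from comparing the structural conditions of two
solutions of the Riemann–Hilbert problem at `k = i/2` forces `q₁ = q₂`, `f₁ = f₂`, `B = 0`. -/
theorem statement15 (q₁ q₂ f₁ f₂ : ℝ)
    (hq₁ : 0 < q₁) (hq₂ : 0 < q₂) (hf₁ : 0 < f₁) (hf₂ : 0 < f₂) (B : ℂ)
    (h1 : (f₂ : ℂ) * ((q₂ : ℂ) + (q₂ : ℂ)⁻¹ - 4 * B * (q₂ : ℂ))
        = (f₁ : ℂ) * ((q₁ : ℂ) + (q₁ : ℂ)⁻¹))
    (h2 : (f₂ : ℂ)⁻¹ * ((q₂ : ℂ) - (q₂ : ℂ)⁻¹ - 4 * B * (q₂ : ℂ))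
        = (f₁ : ℂ)⁻¹ * ((q₁ : ℂ) - (q₁ : ℂ)⁻¹))
    (h3 : (f₂ : ℂ) * ((q₂ : ℂ) - (q₂ : ℂ)⁻¹ + 4 * B * (q₂ : ℂ))
        = (f₁ : ℂ) * ((q₁ : ℂ) - (q₁ : ℂ)⁻¹))
    (h4 : (f₂ : ℂ)⁻¹ * ((q₂ : ℂ) + (q₂ : ℂ)⁻¹ + 4 * B * (q₂ : ℂ))
        = (f₁ : ℂ)⁻¹ * ((q₁ : ℂ) + (q₁ : ℂ)⁻¹)) :
    q₁ = q₂ ∧ f₁ = f₂ ∧ B = 0 := by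
  have h_mul : f₂ * q₂ = f₁ * q₁ := by
    have h : (f₂ : ℂ) * q₂ = f₁ * q₁ := by linear_combination (h1 + h3) / 2
    exact_mod_cast h
  have h_div : f₂⁻¹ * q₂ = f₁⁻¹ * q₁ := by
    have h : (f₂ : ℂ)⁻¹ * q₂ = (f₁ : ℂ)⁻¹ * q₁ := by linear_combination (h2 + h4) / 2
    exact_mod_cast h
  have hq : q₁ = q₂ := by
    have h : (f₂ * q₂) * (f₂⁻¹ * q₂) = (f₁ * q₁) * (f₁⁻¹ * q₁) := by rw [h_mul, h_div]
    field_simp at h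
    nlinarith
  subst hq
  have hf : f₁ = f₂ := (mul_right_cancel₀ hq₁.ne' h_mul).symm
  subst hf
  refine ⟨rfl, rfl, ?_⟩
  have hf₀ : (f₁ : ℂ) ≠ 0 := by exact_mod_cast hf₁.ne'
  have hq₀ : (q₁ : ℂ) ≠ 0 := by exact_mod_cast hq₁.ne'
  have hB : (f₁ : ℂ) * q₁ * B = 0 := by linear_combination -h1 / 4
  exact (mul_eq_zero.mp hB).resolve_left (mul_ne_zero hf₀ hq₀)
end

section
/- Let E, a, a', b, b', R, R' ∈ ℂ with E ≠ 0, a ≠ 0, a a' − b b' = 1, −E b' R² + (E a' − a) R + b = 0, −E^{−1} b (R')² + (E^{−1} a − a') R' + b' = 0, R b' E = −R' b, and (a − b R')(a' − b' R) = 1. Define G := R'/E + b'/a and G₁ := a² R − a b. Then the 2×2 complex matrix product [[1/a, 0], [0, a]] · [[1, −G₁], [0, 1]] · [[1, 0], [G, 1]] · [[a − b R', −b], [0, a' − b' R]] equals [[1 − R' R, −R], [R', 1]]. -/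
open Matrix

/-- equality of jump matrices in the verification of periodicity for the
Camassa–Holm equation: the `2×2` matrix product
`diag(a⁻¹, a) · [[1,−G₁],[0,1]] · [[1,0],[G,1]] · [[a−bR', −b],[0, a'−b'R]]`
equals `[[1−R'R, −R],[R', 1]]`. -/
theorem statement16 (E a a' b b' R R' : ℂ) (hE : E ≠ 0) (ha : a ≠ 0)
    (hdet : a * a' - b * b' = 1)
    (hq : -E * b' * R ^ 2 + (E * a' - a) * R + b = 0)
    (hq' : -E⁻¹ * b * R' ^ 2 + (E⁻¹ * a - a') * R' + b' = 0)
    (hsym : R * b' * E = -(R' * b))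
    (hprod : (a - b * R') * (a' - b' * R) = 1)
    (G G₁ : ℂ) (hG : G = R' / E + b' / a) (hG₁ : G₁ = a ^ 2 * R - a * b) :
    !![a⁻¹, 0; 0, a] * !![1, -G₁; 0, 1] * !![1, 0; G, 1]
        * !![a - b * R', -b; 0, a' - b' * R]
      = !![1 - R' * R, -R; R', 1] := by
  have hsym' : R * b' = -(R' * b) * E⁻¹ := by
    rw [← hsym, mul_assoc, mul_inv_cancel₀ hE, mul_one]
  have haG : a * G = a * R' * E⁻¹ + b' := by
    rw [hG]
    field_simp
  have h21 : a * G * (a - b * R') = R' := by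
    rw [haG]
    linear_combination a * hq' + R' * hdet
  have h22 : a * (a' - b' * R) - a * G * b = 1 := by
    rw [haG]
    linear_combination hdet - a * hsym'
  have hG₁' : G₁ * a⁻¹ = a * R - b := by
    rw [hG₁]
    field_simp
  have hinv : a * a⁻¹ = 1 := mul_inv_cancel₀ ha
  ext i j
  fin_cases i <;> fin_cases j <;> simp [Matrix.mul_apply, Fin.sum_univ_two]
  · linear_combination -(G * (a - b * R')) * hG₁' + (b * a⁻¹ - R) * h21 +
      (1 - b * G * (a - b * R')) * hinv
  · linear_combination -(a' - b' * R - G * b) * hG₁' + (b * a⁻¹ - R) * h22 -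
      b * (a' - b' * R - G * b) * hinv
  · linear_combination h21
  · linear_combination h22
end

section
/- Let E, a, a', b, b', R₊, R₋ ∈ ℂ with E ≠ 0, b' ≠ 0, R₊ ≠ 0, R₋ ≠ 0, a a' − b b' = 1, and suppose R₊ and R₋ are the two roots of the quadratic polynomial −E b' X² + (E a' − a) X + b, i.e. R₊ + R₋ = (E a' − a)/(E b') and R₊ R₋ = −b/(E b'). Set R'₊ := 1/R₋ and R'₋ := 1/R₊. Then the 2×2 complex matrix product [[a' − b' R₋, b], [0, a − b R'₋]] · [[1, 0], [E^{−1}(R'₊ − R'₋), 1]] · [[a − b R'₊, −b], [0, a' − b' R₊]] equals [[1, 0], [R'₊ − R'₋, 1]]. -/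
open Matrix

/-- equality of jump matrices across a vertical branch-cut segment in the
verification of periodicity for the Camassa–Holm equation, with `R'₊ = 1/R₋`, `R'₋ = 1/R₊`. -/
theorem statement17 (E a a' b b' Rp Rm : ℂ) (hE : E ≠ 0) (hb' : b' ≠ 0)
    (hRp : Rp ≠ 0) (hRm : Rm ≠ 0)
    (hdet : a * a' - b * b' = 1)
    (hsum : Rp + Rm = (E * a' - a) / (E * b'))
    (hprod : Rp * Rm = -b / (E * b')) :
    !![a' - b' * Rm, b; 0, a - b * (1/Rp)] * !![1, 0; E⁻¹ * ((1/Rm) - (1/Rp)), 1]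
        * !![a - b * (1/Rm), -b; 0, a' - b' * Rp]
      = !![1, 0; (1/Rm) - (1/Rp), 1] := by
  have hb : b = -(E * b' * (Rp * Rm)) := by
    rw [hprod]; field_simp
  have ha : a = E * a' - E * b' * (Rp + Rm) := by
    rw [hsum]; field_simp; ring
  have hp : a - b * (1/Rp) = E * (a' - b' * Rp) := by
    rw [ha, hb]; field_simp; ring
  have hm : a - b * (1/Rm) = E * (a' - b' * Rm) := by
    rw [ha, hb]; field_simp; ring
  have hd : b * ((1/Rm) - (1/Rp)) = -(E * b' * (Rp - Rm)) := by
    rw [hb]; field_simp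
  have hpm : E * (a' - b' * Rp) * (a' - b' * Rm) = 1 := by
    rw [← hdet, ha, hb]; ring
  have hEE : E⁻¹ * E = 1 := inv_mul_cancel₀ hE
  rw [hp, hm]
  generalize (1/Rm) - (1/Rp) = d at hd ⊢
  ext i j
  fin_cases i <;> fin_cases j <;> simp [Matrix.mul_apply, Fin.sum_univ_two]
  · linear_combination hpm + (a' - b' * Rm) * hd + (a' - b' * Rm) * b * d * hEE
  · linear_combination (-b * E⁻¹) * hd + b * b' * (Rp - Rm) * hEE
  · linear_combination d * hpm + E * (a' - b' * Rp) * d * (a' - b' * Rm) * hEE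
  · linear_combination hpm - (a' - b' * Rp) * hd - (a' - b' * Rp) * d * b * hEE
end
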